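/- Let T be a tableau of shape (k,k) over the type D_n alphabet satisfying conditions (1), (2) and (3) of Criterion 1. Then T satisfies condition (4) of Criterion 1 if and only if T satisfies condition (4a): no two adjacent columns of T form (n−1 over n)(n over \overline{n−1}) or (n−1 over n̄)(n̄ over \overline{n−1}). Consequently, Criterion 1 is unchanged if condition (4) is replaced by condition (4a). -/

import Mathlib

namespace KR

/-- A letter of the type `Dₙ` alphabet: `pos i` is the unbarred letter `i`
(1-based, valid when `1 ≤ i ≤ n`), `neg i` is the barred letter `ī`. -/
inductive Letter : Type
  | pos : ℕ → Letter
  | neg : ℕ → Letter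
deriving DecidableEq

namespace Letter

/-- The bar involution. -/
def bar : Letter → Letter
  | pos i => neg i
  | neg i => pos i

/-- Validity of a letter for the alphabet of type `Dₙ`. -/
def valid (n : ℕ) : Letter → Prop
  | pos i => 1 ≤ i ∧ i ≤ n
  | neg i => 1 ≤ i ∧ i ≤ n

/-- The partial order `1 < 2 < ⋯ < n-1 < n, n̄ < ⋯ < 2̄ < 1̄`
with `n` and `n̄` incomparable. -/
def le (n : ℕ) : Letter → Letter → Prop
  | pos i, pos j => i ≤ j
  | neg i, neg j => j ≤ i
  | pos i, neg j => ¬ (i = n ∧ j = n)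
  | neg _, pos _ => False

end Letter

/-- A column `(a over b)` of a two-row tableau: `c.1` is the top letter,
`c.2` the bottom letter.  A tableau of shape `(k,k)` is a list of `k` columns. -/
abbrev Col := Letter × Letter

def colValid (n : ℕ) (c : Col) : Prop := c.1.valid n ∧ c.2.valid n

/-- Criterion 1, condition (1): both rows weakly increasing. -/
def cond1 (n : ℕ) (T : List Col) : Prop :=
  List.Chain' (fun c d : Col => Letter.le n c.1 d.1 ∧ Letter.le n c.2 d.2) T

/-- Criterion 1, condition (2): in every column `(a over b)`, `b ≰ a`. -/
def cond2 (n : ℕ) (T : List Col) : Prop := ∀ c ∈ T, ¬ Letter.le n c.2 c.1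

/-- Criterion 1, condition (3): no adjacent columns `(a|x)(a|ā)` or `(a|ā)(y|ā)`. -/
def cond3 (T : List Col) : Prop :=
  List.Chain' (fun c d : Col =>
    ¬ (c.1 = d.1 ∧ d.2 = d.1.bar) ∧ ¬ (c.2 = c.1.bar ∧ d.2 = c.2)) T

/-- Criterion 1, condition (4): no (possibly non-adjacent) pair of columns
`(n-1|n) … (n|‾(n-1))` in that order, nor `(n-1|n̄) … (n̄|‾(n-1))`. -/
def cond4 (n : ℕ) (T : List Col) : Prop :=
  (¬ ∃ i j : ℕ, i < j ∧ T[i]? = some (Letter.pos (n-1), Letter.pos n) ∧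
      T[j]? = some (Letter.pos n, Letter.neg (n-1))) ∧
  (¬ ∃ i j : ℕ, i < j ∧ T[i]? = some (Letter.pos (n-1), Letter.neg n) ∧
      T[j]? = some (Letter.neg n, Letter.neg (n-1)))

/-- Criterion 1, condition (5): no column `(1 over 1̄)`. -/
def cond5 (T : List Col) : Prop := (Letter.pos 1, Letter.neg 1) ∉ T

/-- `B(kϖ₂)`: tableaux of shape `(k,k)` satisfying Criterion 1. -/
def BB (n k : ℕ) : Set (List Col) :=
  {T | T.length = k ∧ (∀ c ∈ T, colValid n c) ∧ cond1 n T ∧ cond2 n T ∧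
       cond3 T ∧ cond4 n T ∧ cond5 T}

/-- `𝒯(s)`: tableaux of shape `(s,s)` satisfying conditions (1), (2), (4). -/
def TT (n s : ℕ) : Set (List Col) :=
  {T | T.length = s ∧ (∀ c ∈ T, colValid n c) ∧ cond1 n T ∧ cond2 n T ∧ cond4 n T}

/-- A letter `a ∈ {1, …, n, n̄}`. -/
def aLetter (n : ℕ) : Letter → Prop
  | .pos i => 1 ≤ i ∧ i ≤ n
  | .neg i => i = n

/-- The column `(1 over 1̄)`. -/
def oneBarOne : Col := (Letter.pos 1, Letter.neg 1)

/-- `T` contains a maximal nonempty block of `m` consecutive columns `(a over ā)`,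
with prefix `L` and suffix `R`. -/
def maxBlock (T : List Col) (a : Letter) (m : ℕ) (L R : List Col) : Prop :=
  0 < m ∧ T = L ++ List.replicate m (a, a.bar) ++ R ∧
  (∀ c, L.getLast? = some c → c ≠ (a, a.bar)) ∧
  (∀ c, R.head? = some c → c ≠ (a, a.bar))

/-- The drop map `D_{2,s}` as a relation: `DropRel n s T T'` holds when `T'` is the
result of applying `D_{2,s}` to `T`. -/
def DropRel (n s : ℕ) (T T' : List Col) : Prop :=
  (T = List.replicate s oneBarOne ∧ T' = []) ∨
  (T ∈ BB n s ∧ T' = T) ∨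
  (T ≠ List.replicate s oneBarOne ∧ T ∉ BB n s ∧
    ∃ a m L R, aLetter n a ∧ maxBlock T a m L R ∧ T' = L ++ R)

/-- Criterion 2 at the (0-based) adjacent pair `(t[i], t[i+1])`:
`bᵢ ≤ āᵢ ≤ b_{i+1}` or `aᵢ ≤ ‾b_{i+1} ≤ a_{i+1}` (paper position `i+1`). -/
def crit2At (n : ℕ) (t : List Col) (i : ℕ) : Prop :=
  ∃ c d : Col, t[i]? = some c ∧ t[i+1]? = some d ∧
    ((Letter.le n c.2 c.1.bar ∧ Letter.le n c.1.bar d.2) ∨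
     (Letter.le n c.1 d.2.bar ∧ Letter.le n d.2.bar d.1))

/-- `i` is a filling location of `t` (paper indexing: `1 ≤ i ≤ k-1` interior,
`i = k` appending, `i = 0` prepending). -/
def isFillingLoc (n s : ℕ) (t : List Col) (i : ℕ) : Prop :=
  (1 ≤ i ∧ i + 1 ≤ t.length ∧ crit2At n t (i-1)) ∨
  (i = t.length ∧ 0 < t.length ∧ (∀ j, ¬ crit2At n t j) ∧
    ∃ c : Col, t.getLast? = some c ∧
      t ++ List.replicate (s - t.length) (c.1, c.1.bar) ∈ TT n s) ∨
  (i = 0 ∧ 0 < t.length ∧ (∀ j, ¬ crit2At n t j) ∧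
    ∃ c : Col, t.head? = some c ∧
      List.replicate (s - t.length) (c.2.bar, c.2) ++ t ∈ TT n s)

/-- `T` is a result of filling `t` at location `i` (inserting `s - k` columns). -/
def fillAtRel (n s : ℕ) (t : List Col) (i : ℕ) (T : List Col) : Prop :=
  (1 ≤ i ∧ i + 1 ≤ t.length ∧
    ∃ c d : Col, t[i-1]? = some c ∧ t[i]? = some d ∧
      ((Letter.le n c.2 c.1.bar ∧ Letter.le n c.1.bar d.2 ∧
         T = t.take i ++ List.replicate (s - t.length) (c.1, c.1.bar) ++ t.drop i) ∨
       (Letter.le n c.1 d.2.bar ∧ Letter.le n d.2.bar d.1 ∧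
         T = t.take i ++ List.replicate (s - t.length) (d.2.bar, d.2) ++ t.drop i))) ∨
  (i = t.length ∧ 0 < t.length ∧ (∀ j, ¬ crit2At n t j) ∧
    ∃ c : Col, t.getLast? = some c ∧
      T = t ++ List.replicate (s - t.length) (c.1, c.1.bar)) ∨
  (i = 0 ∧ 0 < t.length ∧ (∀ j, ¬ crit2At n t j) ∧
    ∃ c : Col, t.head? = some c ∧
      T = List.replicate (s - t.length) (c.2.bar, c.2) ++ t)

/-- The fill map `F_{2,s}` as a relation. -/
def FillRel (n s : ℕ) (t T : List Col) : Prop :=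
  (t.length = s ∧ T = t) ∨
  (t = [] ∧ T = List.replicate s oneBarOne) ∨
  (t ≠ [] ∧ t.length < s ∧ ∃ i, isFillingLoc n s t i ∧ fillAtRel n s t i T)

/-- `T` contains an `a`-configuration of size `m` (one of the three types of
Proposition `ablock`). -/
def hasAConfig (T : List Col) (a : Letter) (m : ℕ) : Prop :=
  (∃ L R : List Col, ∃ b c d : Letter, b ≠ a.bar ∧ (c ≠ a ∨ d ≠ a.bar) ∧
     T = L ++ [(a, b)] ++ List.replicate m (a, a.bar) ++ [(c, d)] ++ R) ∨
  (∃ L R : List Col, ∃ b c d : Letter, d ≠ a ∧ (b ≠ a ∨ c ≠ a.bar) ∧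
     T = L ++ [(b, c)] ++ List.replicate m (a, a.bar) ++ [(d, a.bar)] ++ R) ∨
  (∃ L R : List Col, ∃ b c d e : Letter, b ≠ a ∧ e ≠ a.bar ∧
     T = L ++ [(b, c)] ++ List.replicate (m+1) (a, a.bar) ++ [(d, e)] ++ R)

/-- Condition (4a): no two *adjacent* columns form `(n-1|n)(n|‾(n-1))` or
`(n-1|n̄)(n̄|‾(n-1))`. -/
def cond4a (n : ℕ) (T : List Col) : Prop :=
  List.Chain' (fun c d : Col =>
    ¬ (c = (Letter.pos (n-1), Letter.pos n) ∧ d = (Letter.pos n, Letter.neg (n-1))) ∧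
    ¬ (c = (Letter.pos (n-1), Letter.neg n) ∧ d = (Letter.neg n, Letter.neg (n-1)))) T

theorem le_trans_valid (n : ℕ) {a b c : Letter} (ha : a.valid n) (hb : b.valid n)
    (hc : c.valid n) (hab : Letter.le n a b) (hbc : Letter.le n b c) : Letter.le n a c := by
  cases a <;> cases b <;> cases c <;> simp only [Letter.le, Letter.valid] at * <;> omega

/-- Comparison of any two columns in order, together with validity. -/
theorem cols_le (n : ℕ) (T : List Col) (hvalid : ∀ c ∈ T, colValid n c) (h1 : cond1 n T)
    (i d : ℕ) (h : i + d + 1 < T.length) :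
    Letter.le n (T[i]).1 (T[i + d + 1]).1 ∧ Letter.le n (T[i]).2 (T[i + d + 1]).2 := by
  have hs := List.isChain_iff_getElem.1 h1
  have hv : ∀ m (hm : m < T.length), colValid n T[m] := fun m hm => hvalid _ (List.getElem_mem hm)
  induction d with
  | zero => exact hs i h
  | succ d ih =>
    have hprev := ih (by omega)
    have hstep := hs (i + d + 1) (by omega)
    exact ⟨le_trans_valid n (hv i (by omega)).1 (hv (i + d + 1) (by omega)).1 (hv _ h).1 hprev.1 hstep.1,
      le_trans_valid n (hv i (by omega)).2 (hv (i + d + 1) (by omega)).2 (hv _ h).2 hprev.2 hstep.2⟩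

/-- If a column following `P` and weakly preceding `Q` has to be `P` again, then `Q` never
occurs after `P`. -/
theorem no_pair (n : ℕ) (T : List Col) (hvalid : ∀ c ∈ T, colValid n c)
    (h1 : cond1 n T) (h2 : cond2 n T) (h3 : cond3 T) (h4 : cond4a n T) (P Q : Col) (hPQ : P ≠ Q)
    (key : ∀ d : Col, colValid n d → ¬ Letter.le n d.2 d.1 →
      (Letter.le n P.1 d.1 ∧ Letter.le n P.2 d.2) →
      (¬ (P.1 = d.1 ∧ d.2 = d.1.bar) ∧ ¬ (P.2 = P.1.bar ∧ d.2 = P.2)) →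
      (d = Q ∨ Letter.le n d.1 Q.1 ∧ Letter.le n d.2 Q.2) → d = P ∨ d = Q)
    (key4 : ¬ (¬ (P = (Letter.pos (n-1), Letter.pos n) ∧ Q = (Letter.pos n, Letter.neg (n-1))) ∧
    ¬ (P = (Letter.pos (n-1), Letter.neg n) ∧ Q = (Letter.neg n, Letter.neg (n-1))))) :
    ¬ ∃ i j : ℕ, i < j ∧ T[i]? = some P ∧ T[j]? = some Q := by
  rintro ⟨i, j, hij, hi, hj⟩
  obtain ⟨hil, hi⟩ := List.getElem?_eq_some_iff.1 hi
  obtain ⟨hjl, hj⟩ := List.getElem?_eq_some_iff.1 hj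
  have hs1 := List.isChain_iff_getElem.1 h1
  have hs3 := List.isChain_iff_getElem.1 h3
  have hs4 := List.isChain_iff_getElem.1 h4
  have main : ∀ m (hm : i + m ≤ j), T[i + m]'(by omega) = P := by
    intro m
    induction m with
    | zero => intro _; exact hi
    | succ m ih =>
      intro hm
      have e := ih (by omega)
      have a1 := hs1 (i + m) (by omega)
      have a3 := hs3 (i + m) (by omega)
      have a4 := hs4 (i + m) (by omega)
      rw [e] at a1 a3 a4
      have hmem := List.getElem_mem (l := T) (n := i + m + 1) (by omega)
      have hQ : T[i + m + 1]'(by omega) = Q ∨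
          Letter.le n (T[i + m + 1]'(by omega)).1 Q.1 ∧
          Letter.le n (T[i + m + 1]'(by omega)).2 Q.2 := by
        rcases Nat.lt_or_ge (i + m + 1) j with hlt | hge
        · right
          obtain ⟨d, rfl⟩ : ∃ d, j = i + m + 1 + d + 1 := ⟨j - (i + m + 1) - 1, by omega⟩
          have := cols_le n T hvalid h1 (i + m + 1) d hjl
          rwa [hj] at this
        · left
          obtain rfl : j = i + m + 1 := by omega
          exact hj
      rcases key _ (hvalid _ hmem) (h2 _ hmem) a1 a3 hQ with h | h
      · exact h
      · rw [h] at a4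
        exact absurd a4 key4
  have := main (j - i) (by omega)
  have e : i + (j - i) = j := by omega
  simp only [e] at this
  exact hPQ (this.symm.trans hj)

/-- For a tableau of shape `(k,k)` over the type `Dₙ` alphabet
satisfying conditions (1), (2) and (3) of Criterion 1, condition (4) holds if and
only if condition (4a) holds; consequently Criterion 1 is unchanged if (4) is
replaced by (4a). -/
theorem cond4_iff_cond4a (n k : ℕ) (hn : 4 ≤ n) (T : List Col)
    (hlen : T.length = k) (hvalid : ∀ c ∈ T, colValid n c)
    (h1 : cond1 n T) (h2 : cond2 n T) (h3 : cond3 T) :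
    cond4 n T ↔ cond4a n T := by
  constructor
  · rintro ⟨ha, hb⟩
    refine List.isChain_iff_getElem.2 fun i hi => ⟨?_, ?_⟩
    · rintro ⟨e, f⟩
      exact ha ⟨i, i + 1, by omega, List.getElem?_eq_some_iff.2 ⟨_, e⟩,
        List.getElem?_eq_some_iff.2 ⟨_, f⟩⟩
    · rintro ⟨e, f⟩
      exact hb ⟨i, i + 1, by omega, List.getElem?_eq_some_iff.2 ⟨_, e⟩,
        List.getElem?_eq_some_iff.2 ⟨_, f⟩⟩
  · intro h4
    constructor
    · refine no_pair n T hvalid h1 h2 h3 h4 _ _ (by simp) ?_ (by simp)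
      rintro ⟨a, b⟩ hv hc hP hthree hQ
      cases a <;> cases b <;>
        simp [Letter.le, Letter.valid, colValid, Letter.bar] at * <;> omega
    · refine no_pair n T hvalid h1 h2 h3 h4 _ _ (by simp) ?_ (by simp)
      rintro ⟨a, b⟩ hv hc hP hthree hQ
      cases a <;> cases b <;>
        simp [Letter.le, Letter.valid, colValid, Letter.bar] at * <;> omega

end KR
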